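/- There exists C₀ > 0 such that for every 0 < C < C₀ the function ρ(x,u,y,v) = x² − yv² + (9/4)u² − y³ + C(xy − (3/2)uv) is strictly plurisubharmonic in a neighborhood of the origin: there is δ > 0 such that for all p with |p| < δ and all v ∈ ℝ⁴ with v ≠ 0, one has H_ρ(p)(v,v) + H_ρ(p)(Jv,Jv) > 0. -/

import Mathlib

noncomputable section

/-- The defining function `ρ(x,u,y,v) = x² − yv² + (9/4)u² − y³ + C(xy − (3/2)uv)`
of the auxiliary hypersurface `M`. -/
def rho (C : ℝ) (p : Fin 4 → ℝ) : ℝ :=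
  p 0 ^ 2 - p 2 * p 3 ^ 2 + 9 / 4 * p 1 ^ 2 - p 2 ^ 3
    + C * (p 0 * p 2 - 3 / 2 * p 1 * p 3)

/-- The standard complex structure `J` on `ℝ⁴ ≅ ℂ²`: `J(x,u,y,v) = (−y,−v,x,u)`. -/
def Jstd (w : Fin 4 → ℝ) : Fin 4 → ℝ :=
  ![-(w 2), -(w 3), w 0, w 1]

/-- The real Hessian bilinear form of `g : ℝ⁴ → ℝ` at `p`, applied to vectors `v`, `w`. -/
def realHessian (g : (Fin 4 → ℝ) → ℝ) (p v w : Fin 4 → ℝ) : ℝ :=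
  fderiv ℝ (fun q => fderiv ℝ g q w) p v

theorem fderiv_rho_apply (C : ℝ) (q w : Fin 4 → ℝ) :
    fderiv ℝ (rho C) q w = (2 * q 0 + C * q 2) * w 0 + (9 / 2 * q 1 - 3 / 2 * C * q 3) * w 1
      + (C * q 0 - q 3 ^ 2 - 3 * q 2 ^ 2) * w 2 - (2 * q 2 * q 3 + 3 / 2 * C * q 1) * w 3 := by
  have h (i : Fin 4) := hasFDerivAt_apply (𝕜 := ℝ) i q
  have hρ : HasFDerivAt (rho C) _ q :=
    (((((h 0).pow 2).sub ((h 2).mul ((h 3).pow 2))).add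
      (((h 1).pow 2).const_mul (9 / 4))).sub ((h 2).pow 3)).add
      ((((h 0).mul (h 2)).sub (((h 1).const_mul (3 / 2)).mul (h 3))).const_mul C)
  rw [hρ.fderiv]
  simp
  ring

theorem realHessian_rho_self (C : ℝ) (p w : Fin 4 → ℝ) :
    realHessian (rho C) p w w = 2 * w 0 ^ 2 + 9 / 2 * w 1 ^ 2 - 6 * p 2 * w 2 ^ 2
      - 2 * p 2 * w 3 ^ 2 - 4 * p 3 * (w 2 * w 3) + C * (2 * (w 0 * w 2) - 3 * (w 1 * w 3)) := by
  have h (i : Fin 4) := hasFDerivAt_apply (𝕜 := ℝ) i p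
  have hd : HasFDerivAt (fun q : Fin 4 → ℝ =>
      (2 * q 0 + C * q 2) * w 0 + (9 / 2 * q 1 - 3 / 2 * C * q 3) * w 1
      + (C * q 0 - q 3 ^ 2 - 3 * q 2 ^ 2) * w 2 - (2 * q 2 * q 3 + 3 / 2 * C * q 1) * w 3) _ p :=
    ((((((h 0).const_mul 2).add ((h 2).const_mul C)).mul_const (w 0)).add
      ((((h 1).const_mul (9 / 2)).sub ((h 3).const_mul (3 / 2 * C))).mul_const (w 1))).add
      (((((h 0).const_mul C).sub ((h 3).pow 2)).sub (((h 2).pow 2).const_mul 3)).mul_const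
        (w 2))).sub
      (((((h 2).const_mul 2).mul (h 3)).add ((h 1).const_mul (3 / 2 * C))).mul_const (w 3))
  simp only [realHessian, fderiv_rho_apply]
  rw [hd.fderiv]
  simp
  ring

/-- The terms of the Levi form of `rho C` involving `C` cancel. -/
theorem levi_rho (C : ℝ) (p w : Fin 4 → ℝ) :
    realHessian (rho C) p w w + realHessian (rho C) p (Jstd w) (Jstd w) =
      (2 - 6 * p 2) * (w 0 ^ 2 + w 2 ^ 2) + (9 / 2 - 2 * p 2) * (w 1 ^ 2 + w 3 ^ 2)
        - 4 * p 3 * (w 0 * w 1 + w 2 * w 3) := by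
  simp only [realHessian_rho_self]
  simp [Jstd]
  ring

/-- There exists `C₀ > 0` such that for every `0 < C < C₀` the function `ρ` is strictly
plurisubharmonic near the origin: there is `δ > 0` such that the Levi form
`H_ρ(p)(v,v) + H_ρ(p)(Jv,Jv)` is strictly positive for all `|p| < δ` and all `v ≠ 0`. -/
theorem rho_strictly_plurisubharmonic :
    ∃ C₀ > (0 : ℝ), ∀ C : ℝ, 0 < C → C < C₀ → ∃ δ > (0 : ℝ),
      ∀ p : Fin 4 → ℝ, ‖p‖ < δ → ∀ v : Fin 4 → ℝ, v ≠ 0 →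
        0 < realHessian (rho C) p v v + realHessian (rho C) p (Jstd v) (Jstd v) := by
  refine ⟨1, one_pos, fun C _ _ => ⟨1 / 10, by norm_num, fun p hp w hw => ?_⟩⟩
  rw [levi_rho]
  have hcoord (i : Fin 4) : |p i| < 1 / 10 := (norm_le_pi_norm p i).trans_lt hp
  obtain ⟨-, hy⟩ := abs_lt.mp (hcoord 2)
  obtain ⟨hv₁, hv₂⟩ := abs_lt.mp (hcoord 3)
  have hpos : 0 < w 0 ^ 2 + w 2 ^ 2 + (w 1 ^ 2 + w 3 ^ 2) := by
    obtain ⟨i, hi⟩ := Function.ne_iff.mp hw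
    have hi' : 0 < w i ^ 2 := sq_pos_of_ne_zero hi
    fin_cases i <;> simp only [Fin.zero_eta, Fin.mk_one, Fin.reduceFinMk] at hi' <;> positivity
  have hA : 0 ≤ w 0 ^ 2 + w 2 ^ 2 := by positivity
  have hB : 0 ≤ w 1 ^ 2 + w 3 ^ 2 := by positivity
  have h₁ := mul_nonneg (sub_nonneg.mpr hy.le) hA
  have h₂ := mul_nonneg (sub_nonneg.mpr hy.le) hB
  have h₃ : 0 ≤ (1 / 10 - p 3) * ((w 0 + w 1) ^ 2 + (w 2 + w 3) ^ 2) :=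
    mul_nonneg (by linarith) (by positivity)
  have h₄ : 0 ≤ (1 / 10 + p 3) * ((w 0 - w 1) ^ 2 + (w 2 - w 3) ^ 2) :=
    mul_nonneg (by linarith) (by positivity)
  nlinarith
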